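/- Let G be a digraph on n vertices in which every vertex has outdegree at most d. Then the number of subsets S ⊆ V such that G[S] is strongly connected is at most γⁿ + n, where γ = (2^{d+1} − 1)^{1/(d+1)}. -/

import Mathlib

open scoped Classical

variable {V : Type*}

/-- `b` is reachable from `a` by a (possibly empty) directed path staying inside `S`. -/
def ReachIn (E : V → V → Prop) (S : Finset V) (a b : V) : Prop :=
  Relation.ReflTransGen (fun x y => x ∈ S ∧ y ∈ S ∧ E x y) a b

/-- The induced subdigraph `G[S]` is strongly connected. -/
def StronglyConnIn (E : V → V → Prop) (S : Finset V) : Prop :=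
  ∀ a ∈ S, ∀ b ∈ S, ReachIn E S a b

/-- The induced subdigraph `G[S]` contains at least one edge. -/
def HasEdgeIn (E : V → V → Prop) (S : Finset V) : Prop :=
  ∃ a ∈ S, ∃ b ∈ S, E a b

/-- `G[S]` is acyclic: every strongly connected component of `G[S]` is trivial,
equivalently there is no edge lying on a closed walk inside `S`. -/
def AcyclicIn (E : V → V → Prop) (S : Finset V) : Prop :=
  ¬ ∃ a ∈ S, ∃ b ∈ S, E a b ∧ ReachIn E S b a

open Classical in
/-- The strongly connected component of `v` in the induced subdigraph `G[S]`. -/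
noncomputable def sccOf [DecidableEq V] (E : V → V → Prop) (S : Finset V) (v : V) : Finset V :=
  S.filter (fun u => ReachIn E S v u ∧ ReachIn E S u v)

open Classical in
/-- Fuel-based auxiliary function implementing the recursive definition of cycle rank. -/
noncomputable def crankAux [DecidableEq V] (E : V → V → Prop) : ℕ → Finset V → ℕ
  | 0, _ => 0
  | n + 1, S =>
    if AcyclicIn E S then 0
    else if StronglyConnIn E S then
      1 + sInf {m | ∃ v ∈ S, crankAux E n (S.erase v) = m}
    else
      S.sup (fun v => crankAux E n (sccOf E S v))

/-- The cycle rank of the digraph `(V, E)`. -/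
noncomputable def crank [DecidableEq V] [Fintype V] (E : V → V → Prop) : ℕ :=
  crankAux E (Fintype.card V) Finset.univ


theorem aux_holder {ι : Type*} (J : Finset ι) (a b c : ι → ℝ) (t : ℕ) (ht : 0 < t)
    (hJ : J.card = t) (ha : ∀ i ∈ J, 0 ≤ a i) (hb : ∀ i ∈ J, 0 ≤ b i)
    (hc : ∀ i ∈ J, 0 < c i) (habc : ∀ i ∈ J, a i + b i ≤ c i) (P x y : ℝ) (hP : 0 ≤ P)
    (hx0 : 0 ≤ x) (hy0 : 0 ≤ y)
    (hx : x ^ t ≤ (∏ i ∈ J, a i) * P) (hy : y ^ t ≤ (∏ i ∈ J, b i) * P) :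
    (x + y) ^ t ≤ (∏ i ∈ J, c i) * P := by
  have htR : (0:ℝ) < t := by exact_mod_cast ht
  have hQ0 : 0 ≤ (∏ i ∈ J, c i) * P :=
    mul_nonneg (Finset.prod_nonneg fun i hi => (hc i hi).le) hP
  set R : ℝ := ((∏ i ∈ J, c i) * P) ^ ((t:ℝ)⁻¹) with hR
  have hR0 : 0 ≤ R := Real.rpow_nonneg hQ0 _
  have key : ∀ (f : ι → ℝ) (z : ℝ), (∀ i ∈ J, 0 ≤ f i) → 0 ≤ z →
      z ^ t ≤ (∏ i ∈ J, f i) * P → z ≤ (∑ i ∈ J, (t:ℝ)⁻¹ * (f i / c i)) * R := by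
    intro f z hf hz h
    have hpos : ∀ i ∈ J, 0 ≤ f i / c i := fun i hi => div_nonneg (hf i hi) (hc i hi).le
    have e1 : (∏ i ∈ J, f i) * P = (∏ i ∈ J, f i / c i) * ((∏ i ∈ J, c i) * P) := by
      rw [← mul_assoc, ← Finset.prod_mul_distrib]
      congr 1
      refine Finset.prod_congr rfl fun i hi => ?_
      rw [div_mul_cancel₀ _ (hc i hi).ne']
    have e2 : z = (z ^ t) ^ ((t:ℝ)⁻¹) := (Real.pow_rpow_inv_natCast hz ht.ne').symm
    have e3 : (z ^ t) ^ ((t:ℝ)⁻¹) ≤ ((∏ i ∈ J, f i / c i) * ((∏ i ∈ J, c i) * P)) ^ ((t:ℝ)⁻¹) := by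
      rw [← e1]
      exact Real.rpow_le_rpow (pow_nonneg hz _) h (by positivity)
    rw [Real.mul_rpow (Finset.prod_nonneg hpos) hQ0, ← Real.finsetProd_rpow _ _ hpos] at e3
    have e4 := Real.geom_mean_le_arith_mean_weighted J (fun _ => (t:ℝ)⁻¹) (fun i => f i / c i)
      (fun _ _ => by positivity) (by simp [hJ, htR.ne']) hpos
    rw [e2]
    exact e3.trans (mul_le_mul_of_nonneg_right e4 hR0)
  have h1 := key a x ha hx0 hx
  have h2 := key b y hb hy0 hy
  have h3 : (∑ i ∈ J, (t:ℝ)⁻¹ * (a i / c i)) + (∑ i ∈ J, (t:ℝ)⁻¹ * (b i / c i)) ≤ 1 := by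
    rw [← Finset.sum_add_distrib]
    calc _ ≤ ∑ i ∈ J, (t:ℝ)⁻¹ := by
          refine Finset.sum_le_sum fun i hi => ?_
          rw [← mul_add, ← add_div]
          have : (a i + b i) / c i ≤ 1 := (div_le_one (hc i hi)).2 (habc i hi)
          exact mul_le_of_le_one_right (by positivity) this
      _ = 1 := by simp [hJ, htR.ne']
  have h4 : x + y ≤ R := by nlinarith
  calc (x + y) ^ t ≤ R ^ t := pow_le_pow_left₀ (by positivity) h4 _
    _ = _ := Real.rpow_inv_natCast_pow hQ0 ht.ne'

theorem aux_shearer {V ι : Type*} [DecidableEq V] (I : Finset ι) (A : ι → Finset V)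
    (t : ℕ) (ht : 0 < t) (U : Finset V) :
    (∀ u ∈ U, (I.filter (fun i => u ∈ A i)).card = t) →
    ∀ F : Finset (Finset V), (∀ S ∈ F, S ⊆ U) →
      (F.card : ℝ) ^ t ≤ ∏ i ∈ I, ((F.image (fun S => S ∩ A i)).card : ℝ) := by
  induction U using Finset.induction_on with
  | empty =>
    intro _ F hF
    rcases F.eq_empty_or_nonempty with rfl | hne
    · simp only [Finset.card_empty, Nat.cast_zero]
      rw [zero_pow ht.ne']
      exact Finset.prod_nonneg fun i _ => by positivity
    · have h1 : F.card ≤ 1 := by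
        rw [Finset.card_le_one]
        intro a ha b hb
        rw [Finset.subset_empty.1 (hF a ha), Finset.subset_empty.1 (hF b hb)]
      have h1' : (F.card : ℝ) ≤ 1 := by exact_mod_cast h1
      calc (F.card : ℝ) ^ t ≤ 1 := pow_le_one₀ (by positivity) h1'
        _ ≤ _ := by
          have : ∀ s : Finset ι, (1:ℝ) ≤ ∏ i ∈ s, ((F.image (fun S => S ∩ A i)).card : ℝ) := by
            intro s
            have h : 1 ≤ ∏ i ∈ s, (F.image (fun S => S ∩ A i)).card :=
              Nat.one_le_iff_ne_zero.2 (Finset.prod_ne_zero_iff.2 fun i _ =>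
                (Finset.card_pos.2 (hne.image _)).ne')
            exact_mod_cast h
          exact this I
  | insert u U hu ih =>
    intro hcov F hF
    rcases F.eq_empty_or_nonempty with rfl | hne
    · simp only [Finset.card_empty, Nat.cast_zero]
      rw [zero_pow ht.ne']
      exact Finset.prod_nonneg fun i _ => by positivity
    have ih' := ih (fun w hw => hcov w (Finset.mem_insert_of_mem hw))
    have hx := ih' (F.memberSubfamily u) (by
      intro S hS
      rw [Finset.mem_memberSubfamily] at hS
      intro w hw
      have := hF _ hS.1 (Finset.mem_insert_of_mem hw)
      rcases Finset.mem_insert.1 this with rfl | h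
      · exact absurd hw hS.2
      · exact h)
    have hy := ih' (F.nonMemberSubfamily u) (by
      intro S hS
      rw [Finset.mem_nonMemberSubfamily] at hS
      intro w hw
      have := hF _ hS.1 hw
      rcases Finset.mem_insert.1 this with rfl | h
      · exact absurd hw hS.2
      · exact h)
    have hcard := Finset.card_memberSubfamily_add_card_nonMemberSubfamily u F
    have hcR : (F.card : ℝ) = (F.memberSubfamily u).card + (F.nonMemberSubfamily u).card := by
      exact_mod_cast hcard.symm
    have hsplit : ∀ f : ι → ℝ, ∏ i ∈ I, f i =
        (∏ i ∈ I.filter (fun i => u ∈ A i), f i) * ∏ i ∈ I.filter (fun i => ¬ u ∈ A i), f i :=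
      fun f => (Finset.prod_filter_mul_prod_filter_not I _ f).symm
    rw [hcR, hsplit]
    refine aux_holder _ (fun i => (((F.memberSubfamily u).image (fun S => S ∩ A i)).card : ℝ))
      (fun i => (((F.nonMemberSubfamily u).image (fun S => S ∩ A i)).card : ℝ)) _ t ht
      (hcov u (Finset.mem_insert_self _ _)) (fun _ _ => by positivity) (fun _ _ => by positivity)
      (fun i _ => by exact_mod_cast Finset.card_pos.2 (hne.image _)) ?_ _ _ _
      (Finset.prod_nonneg fun i _ => by positivity) (by positivity) (by positivity) ?_ ?_
    · intro i hi
      have hui : u ∈ A i := (Finset.mem_filter.1 hi).2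
      have h1 : (F.memberSubfamily u).image (fun S => S ∩ A i) ⊆
          (F.image (fun S => S ∩ A i)).memberSubfamily u := by
        intro T hT
        obtain ⟨S, hS, rfl⟩ := Finset.mem_image.1 hT
        rw [Finset.mem_memberSubfamily] at hS ⊢
        refine ⟨Finset.mem_image.2 ⟨_, hS.1, ?_⟩, fun h => hS.2 (Finset.mem_inter.1 h).1⟩
        exact Finset.insert_inter_of_mem hui
      have h2 : (F.nonMemberSubfamily u).image (fun S => S ∩ A i) ⊆
          (F.image (fun S => S ∩ A i)).nonMemberSubfamily u := by
        intro T hT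
        obtain ⟨S, hS, rfl⟩ := Finset.mem_image.1 hT
        rw [Finset.mem_nonMemberSubfamily] at hS ⊢
        exact ⟨Finset.mem_image.2 ⟨_, hS.1, rfl⟩, fun h => hS.2 (Finset.mem_inter.1 h).1⟩
      have h3 := Finset.card_memberSubfamily_add_card_nonMemberSubfamily u
        (F.image (fun S => S ∩ A i))
      have h4 := Finset.card_le_card h1
      have h5 := Finset.card_le_card h2
      have : ((F.memberSubfamily u).image (fun S => S ∩ A i)).card +
        ((F.nonMemberSubfamily u).image (fun S => S ∩ A i)).card ≤
          (F.image (fun S => S ∩ A i)).card := by omega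
      exact_mod_cast this
    · refine hx.trans ?_
      rw [hsplit]
      refine mul_le_mul_of_nonneg_left ?_ (Finset.prod_nonneg fun i _ => by positivity)
      refine Finset.prod_le_prod (fun _ _ => by positivity) fun i hi => ?_
      have hui : u ∉ A i := (Finset.mem_filter.1 hi).2
      refine Nat.cast_le.2 (Finset.card_le_card ?_)
      intro T hT
      obtain ⟨S, hS, rfl⟩ := Finset.mem_image.1 hT
      rw [Finset.mem_memberSubfamily] at hS
      exact Finset.mem_image.2 ⟨_, hS.1, Finset.insert_inter_of_notMem hui⟩
    · refine hy.trans ?_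
      rw [hsplit]
      refine mul_le_mul_of_nonneg_left ?_ (Finset.prod_nonneg fun i _ => by positivity)
      refine Finset.prod_le_prod (fun _ _ => by positivity) fun i hi => ?_
      refine Nat.cast_le.2 (Finset.card_le_card ?_)
      intro T hT
      obtain ⟨S, hS, rfl⟩ := Finset.mem_image.1 hT
      rw [Finset.mem_nonMemberSubfamily] at hS
      exact Finset.mem_image.2 ⟨_, hS.1, rfl⟩

theorem aux_tangent (K x : ℕ) (hK : 0 < K) (hx : 0 < x) :
    Real.log ((2:ℝ) ^ x - 1) ≤ Real.log ((2:ℝ) ^ K - 1) +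
      (Real.log 2 * (2 ^ K / (2 ^ K - 1))) * ((x:ℝ) - K) := by
  have hX : (1:ℝ) < 2 ^ x := one_lt_pow₀ (by norm_num) hx.ne'
  have hY : (1:ℝ) < 2 ^ K := one_lt_pow₀ (by norm_num) hK.ne'
  have lX : Real.log ((2:ℝ) ^ x) = x * Real.log 2 := Real.log_pow _ _
  have lY : Real.log ((2:ℝ) ^ K) = K * Real.log 2 := Real.log_pow _ _
  set X : ℝ := 2 ^ x
  set Y : ℝ := 2 ^ K
  have hX0 : 0 < X := by linarith
  have hY0 : 0 < Y := by linarith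
  have hX1 : 0 < X - 1 := by linarith
  have hY1 : 0 < Y - 1 := by linarith
  have h1 := Real.log_le_sub_one_of_pos (x := ((X - 1) * Y) / ((Y - 1) * X)) (by positivity)
  have h2 := Real.log_le_sub_one_of_pos (x := Y / X) (by positivity)
  rw [Real.log_div (by positivity) (by positivity), Real.log_mul hX1.ne' hY0.ne',
    Real.log_mul hY1.ne' hX0.ne'] at h1
  rw [Real.log_div hY0.ne' hX0.ne'] at h2
  have e : Real.log 2 * (Y / (Y - 1)) * ((x:ℝ) - K) =
      (Real.log X - Real.log Y) + (Real.log X - Real.log Y) / (Y - 1) := by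
    rw [lX, lY]; field_simp; ring
  have h3 : (1 - Y / X) / (Y - 1) ≤ (Real.log X - Real.log Y) / (Y - 1) :=
    div_le_div_of_nonneg_right (by linarith) hY1.le
  have e2 : ((X - 1) * Y) / ((Y - 1) * X) - 1 = (1 - Y / X) / (Y - 1) := by
    field_simp; ring
  rw [e]
  linarith

theorem aux_opt {V : Type*} [Fintype V] (K m : ℕ) (hK : 0 < K) (k : V → ℕ)
    (hk : ∀ v, 0 < k v) (hsum : (∑ v, k v) + m = Fintype.card V * K) :
    (∏ v, ((2:ℝ) ^ k v - 1)) * 2 ^ m ≤ ((2:ℝ) ^ K - 1) ^ Fintype.card V := by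
  have hY : (1:ℝ) < 2 ^ K := one_lt_pow₀ (by norm_num) hK.ne'
  have hpos : ∀ v, (0:ℝ) < 2 ^ k v - 1 := fun v => by
    have : (1:ℝ) < 2 ^ k v := one_lt_pow₀ (by norm_num) (hk v).ne'
    linarith
  have hprod : (0:ℝ) < ∏ v, ((2:ℝ) ^ k v - 1) := Finset.prod_pos fun v _ => hpos v
  have hY1 : (0:ℝ) < 2 ^ K - 1 := by linarith
  rw [← Real.log_le_log_iff (by positivity) (by positivity),
    Real.log_mul hprod.ne' (by positivity), Real.log_prod (fun v _ => (hpos v).ne'),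
    Real.log_pow, Real.log_pow]
  have hs := Finset.sum_le_sum (s := Finset.univ) fun v _ => aux_tangent K (k v) hK (hk v)
  rw [Finset.sum_add_distrib, ← Finset.mul_sum, Finset.sum_sub_distrib] at hs
  simp only [Finset.sum_const, Finset.card_univ, nsmul_eq_mul] at hs
  have hsR : (∑ v, (k v : ℝ)) - Fintype.card V * K = - m := by
    have : (∑ v, (k v : ℝ)) + m = Fintype.card V * K := by exact_mod_cast hsum
    linarith
  rw [hsR] at hs
  have hlog : 0 < Real.log 2 := Real.log_pos (by norm_num)
  have h1 : (1:ℝ) ≤ 2 ^ K / (2 ^ K - 1) := (one_le_div hY1).2 (by linarith)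
  have h2 : Real.log 2 ≤ Real.log 2 * (2 ^ K / (2 ^ K - 1)) := le_mul_of_one_le_right hlog.le h1
  have hm : (0:ℝ) ≤ m := by positivity
  nlinarith [mul_le_mul_of_nonneg_right h2 hm]

theorem aux_main {V : Type*} [DecidableEq V] [Fintype V] (E : V → V → Prop) (d : ℕ)
    (hdeg : ∀ v : V, (Finset.univ.filter (fun u => E v u)).card ≤ d)
    (F : Finset (Finset V)) (hF : ∀ S ∈ F, ∀ v ∈ S, ∃ u ∈ S, u ≠ v ∧ E u v) :
    (F.card : ℝ) ^ (d + 1) ≤ ((2:ℝ) ^ (d + 1) - 1) ^ Fintype.card V := by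
  let R : V → V → Prop := fun u v => u = v ∨ E u v
  let c : V → ℕ := fun u => (Finset.univ.filter (fun v => R u v)).card
  let N : V → Finset V := fun v => Finset.univ.filter (fun u => R u v)
  have hc : ∀ u, c u ≤ d + 1 := by
    intro u
    have : Finset.univ.filter (fun v => R u v) ⊆
        insert u (Finset.univ.filter (fun v => E u v)) := by
      intro v hv
      rcases (Finset.mem_filter.1 hv).2 with h | h
      · simp [h]
      · simp [h]
    exact (Finset.card_le_card this).trans
      ((Finset.card_insert_le _ _).trans (Nat.succ_le_succ (hdeg u)))
  let A : V ⊕ (Σ u : V, Fin (d + 1 - c u)) → Finset V := Sum.elim N (fun p => {p.1})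
  have hsh := aux_shearer Finset.univ A (d + 1) (Nat.succ_pos d) Finset.univ (by
    intro u _
    rw [Finset.card_filter, Fintype.sum_sum_type, Fintype.sum_sigma]
    have h1 : (∑ v : V, if u ∈ A (Sum.inl v) then 1 else 0) = c u := by
      rw [← Finset.card_filter]
      simp [A, N, c]
    have h2 : (∑ w : V, ∑ _j : Fin (d + 1 - c w), if u ∈ A (Sum.inr ⟨w, _j⟩) then 1 else 0)
        = d + 1 - c u := by
      simp [A]
    rw [h1, h2]
    have := hc u
    omega) F (fun S _ => Finset.subset_univ S)
  refine hsh.trans ?_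
  rw [Fintype.prod_sum_type, Fintype.prod_sigma]
  have hsum : (∑ v, (N v).card) + (∑ u, (d + 1 - c u)) = Fintype.card V * (d + 1) := by
    have h1 : ∑ u, c u = ∑ v, (N v).card :=
      Finset.sum_card_bipartiteAbove_eq_sum_card_bipartiteBelow (s := Finset.univ)
        (t := Finset.univ) R
    rw [← h1, ← Finset.sum_add_distrib]
    rw [Finset.sum_congr rfl (g := fun _ => d + 1) (fun u _ => by have := hc u; omega)]
    simp
  have hself : ∀ v, v ∈ N v := fun v => by simp [N, R]
  refine le_trans ?_ (aux_opt (d + 1) _ (Nat.succ_pos d) (fun v => (N v).card)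
    (fun v => Finset.card_pos.2 ⟨v, hself v⟩) hsum)
  refine mul_le_mul ?_ ?_ (Finset.prod_nonneg fun _ _ => Finset.prod_nonneg fun _ _ => by positivity) ?_
  · refine Finset.prod_le_prod (fun _ _ => by positivity) fun v _ => ?_
    have hsub : F.image (fun S => S ∩ A (Sum.inl v)) ⊆ (N v).powerset.erase {v} := by
      intro T hT
      obtain ⟨S, hS, rfl⟩ := Finset.mem_image.1 hT
      refine Finset.mem_erase.2 ⟨fun h => ?_, Finset.mem_powerset.2 Finset.inter_subset_right⟩
      have h : S ∩ N v = {v} := h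
      have hv : v ∈ S := (Finset.mem_inter.1 (h ▸ Finset.mem_singleton_self v)).1
      obtain ⟨u, huS, huv, hE⟩ := hF S hS v hv
      have : u ∈ S ∩ N v := Finset.mem_inter.2 ⟨huS, by simp [N, R, hE]⟩
      rw [h] at this
      exact huv (Finset.mem_singleton.1 this)
    have h1 := Finset.card_le_card hsub
    rw [Finset.card_erase_of_mem (by simp [hself v]), Finset.card_powerset] at h1
    have h2 : (F.image (fun S => S ∩ A (Sum.inl v))).card + 1 ≤ 2 ^ (N v).card := by
      have := Nat.one_le_two_pow (n := (N v).card)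
      omega
    have h3 : ((F.image (fun S => S ∩ A (Sum.inl v))).card : ℝ) + 1 ≤ 2 ^ (N v).card := by
      exact_mod_cast h2
    linarith
  · rw [← Finset.prod_pow_eq_pow_sum]
    refine Finset.prod_le_prod (fun _ _ => Finset.prod_nonneg fun _ _ => by positivity) fun u _ => ?_
    calc _ ≤ ∏ _j : Fin (d + 1 - c u), (2:ℝ) := by
          refine Finset.prod_le_prod (fun _ _ => by positivity) fun j _ => ?_
          have hsub : F.image (fun S => S ∩ A (Sum.inr ⟨u, j⟩)) ⊆ ({u} : Finset V).powerset := by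
            intro T hT
            obtain ⟨S, hS, rfl⟩ := Finset.mem_image.1 hT
            exact Finset.mem_powerset.2 Finset.inter_subset_right
          have h1 := Finset.card_le_card hsub
          rw [Finset.card_powerset, Finset.card_singleton, pow_one] at h1
          exact_mod_cast h1
      _ = _ := by simp
  · refine Finset.prod_nonneg fun v _ => ?_
    have : (1:ℝ) ≤ 2 ^ (N v).card := one_le_pow₀ (by norm_num)
    linarith

theorem aux_pred {V : Type*} (E : V → V → Prop) (S : Finset V) (a v : V) (hne : a ≠ v)
    (h : ReachIn E S a v) : ∃ u ∈ S, u ≠ v ∧ E u v := by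
  unfold ReachIn at h
  induction h with
  | refl => exact absurd rfl hne
  | @tail b c hab hbc ih =>
    by_cases hb : b = c
    · subst hb
      exact ih hne
    · exact ⟨b, hbc.1, hb, hbc.2.2⟩

open Classical in
/-- If every vertex of a digraph `G` on `n` vertices has outdegree at most
`d`, then the number of subsets `S ⊆ V` with `G[S]` strongly connected is at most
`γ^n + n`, where `γ = (2^(d+1) − 1)^(1/(d+1))`. -/
theorem card_stronglyConnected_subsets_le {V : Type*} [DecidableEq V] [Fintype V]
    (E : V → V → Prop) (n d : ℕ) (hn : Fintype.card V = n)
    (hdeg : ∀ v : V, (Finset.univ.filter (fun u => E v u)).card ≤ d) :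
    ((Finset.univ.powerset.filter (fun S : Finset V => StronglyConnIn E S)).card : ℝ) ≤
      (((2 : ℝ) ^ (d + 1) - 1) ^ ((1 : ℝ) / (d + 1))) ^ n + n := by
  subst hn
  set C := Finset.univ.powerset.filter (fun S : Finset V => StronglyConnIn E S) with hC
  set F := C.filter (fun S => S.card ≠ 1) with hFdef
  have hF : ∀ S ∈ F, ∀ v ∈ S, ∃ u ∈ S, u ≠ v ∧ E u v := by
    intro S hS v hv
    obtain ⟨hSC, hS1⟩ := Finset.mem_filter.1 hS
    have hsc : StronglyConnIn E S := (Finset.mem_filter.1 hSC).2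
    have hpos : 0 < S.card := Finset.card_pos.2 ⟨v, hv⟩
    obtain ⟨a, ha, hav⟩ := Finset.exists_mem_ne (s := S) (by omega) v
    exact aux_pred E S a v hav (hsc a ha v hv)
  have hm := aux_main E d hdeg F hF
  have hY : (1:ℝ) ≤ 2 ^ (d + 1) := one_le_pow₀ (by norm_num)
  have hY0 : (0:ℝ) ≤ 2 ^ (d + 1) - 1 := by linarith
  have hFle : (F.card : ℝ) ≤
      (((2 : ℝ) ^ (d + 1) - 1) ^ ((1 : ℝ) / (d + 1))) ^ Fintype.card V := by
    refine le_of_pow_le_pow_left₀ (Nat.succ_ne_zero d) (by positivity) (hm.trans_eq ?_)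
    rw [← pow_mul, mul_comm, pow_mul]
    congr 1
    have := Real.rpow_inv_natCast_pow hY0 (Nat.succ_ne_zero d)
    rw [one_div]
    simpa using this.symm
  have hsing : (C.filter (fun S => ¬ S.card ≠ 1)).card ≤ Fintype.card V := by
    have : C.filter (fun S => ¬ S.card ≠ 1) ⊆ Finset.univ.powersetCard 1 := by
      intro S hS
      have := (Finset.mem_filter.1 hS).2
      exact Finset.mem_powersetCard.2 ⟨Finset.subset_univ _, not_not.1 this⟩
    refine (Finset.card_le_card this).trans ?_
    rw [Finset.card_powersetCard, Nat.choose_one_right, Finset.card_univ]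
  have hsplit : F.card + (C.filter (fun S => ¬ S.card ≠ 1)).card = C.card :=
    Finset.card_filter_add_card_filter_not _
  have h1 : (C.card : ℝ) ≤ F.card + Fintype.card V := by
    have : C.card ≤ F.card + Fintype.card V := by omega
    exact_mod_cast this
  linarith
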